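/- Let Φ be an m×N complex matrix and let c and r be positive integers. Then the restricted isometry constants of Φ satisfy δ_{cr}(Φ) ≤ c · δ_{2r}(Φ). -/

import Mathlib

open Matrix
open scoped BigOperators Classical

/-- The Euclidean (ℓ₂) norm of a finitely indexed complex vector. -/
noncomputable def l2 {ι : Type*} [Fintype ι] (x : ι → ℂ) : ℝ :=
  Real.sqrt (∑ i, ‖x i‖ ^ 2)

/-- The ℓ₁ norm of a finitely indexed complex vector. -/
noncomputable def l1 {ι : Type*} [Fintype ι] (x : ι → ℂ) : ℝ := ∑ i, ‖x i‖

/-- The ℓ∞ (supremum) norm of a finitely indexed complex vector. -/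
noncomputable def linf {ι : Type*} [Fintype ι] (x : ι → ℂ) : ℝ := ⨆ i, ‖x i‖

/-- The support of a vector, as a finite set of coordinates. -/
noncomputable def suppF {N : ℕ} (x : Fin N → ℂ) : Finset (Fin N) :=
  Finset.univ.filter fun i => x i ≠ 0

/-- A vector is `s`-sparse when it has at most `s` nonzero entries. -/
def Sparse {N : ℕ} (s : ℕ) (x : Fin N → ℂ) : Prop := (suppF x).card ≤ s

/-- Restriction of a vector to a set `T` of coordinates: equal to `x` on `T`, zero off `T`. -/
noncomputable def restrictTo {N : ℕ} (x : Fin N → ℂ) (T : Finset (Fin N)) : Fin N → ℂ :=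
  fun i => if i ∈ T then x i else 0

/-- `y` is a best `s`-sparse approximation of `x`: it agrees with `x` on a set of `s`
coordinates of largest magnitude and vanishes elsewhere. -/
def IsSparseApprox {N : ℕ} (s : ℕ) (x y : Fin N → ℂ) : Prop :=
  ∃ T : Finset (Fin N), T.card = min s N ∧ y = restrictTo x T ∧
    ∀ i ∈ T, ∀ j ∉ T, ‖x j‖ ≤ ‖x i‖

/-- The `r`-th restricted isometry constant of `Φ`: the least `δ ≥ 0` such that
`(1-δ)‖x‖² ≤ ‖Φx‖² ≤ (1+δ)‖x‖²` for all `r`-sparse `x`. -/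
noncomputable def RIC {m N : ℕ} (Φ : Matrix (Fin m) (Fin N) ℂ) (r : ℕ) : ℝ :=
  sInf {δ : ℝ | 0 ≤ δ ∧ ∀ x : Fin N → ℂ, Sparse r x →
    (1 - δ) * l2 x ^ 2 ≤ l2 (Φ.mulVec x) ^ 2 ∧ l2 (Φ.mulVec x) ^ 2 ≤ (1 + δ) * l2 x ^ 2}

/-- The column submatrix of `Φ` with columns indexed by the finite set `T`. -/
noncomputable def colSub {m N : ℕ} (Φ : Matrix (Fin m) (Fin N) ℂ) (T : Finset (Fin N)) :
    Matrix (Fin m) {i // i ∈ T} ℂ :=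
  Matrix.of fun r c => Φ r c.1

/-- The least-squares estimate `Φ_T† u = (Φ_T* Φ_T)⁻¹ Φ_T* u`, viewed as a vector in `ℂ^N`
supported on `T`. -/
noncomputable def pinvApply {m N : ℕ} (Φ : Matrix (Fin m) (Fin N) ℂ) (T : Finset (Fin N))
    (u : Fin m → ℂ) : Fin N → ℂ :=
  fun j =>
    if h : j ∈ T then (((colSub Φ T)ᴴ * colSub Φ T)⁻¹ * (colSub Φ T)ᴴ).mulVec u ⟨j, h⟩
    else 0

/-- One iteration of CoSaMP with samples `u` and sparsity level `s`, mapping the current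
approximation `a` to the next approximation `a'`. -/
def CoSaMPStep {m N : ℕ} (Φ : Matrix (Fin m) (Fin N) ℂ) (u : Fin m → ℂ) (s : ℕ)
    (a a' : Fin N → ℂ) : Prop :=
  ∃ y2s : Fin N → ℂ,
    IsSparseApprox (2 * s) (Φᴴ.mulVec (u - Φ.mulVec a)) y2s ∧
    IsSparseApprox s (pinvApply Φ (suppF y2s ∪ suppF a) u) a'

/-- `a` is a sequence of approximations produced by CoSaMP: `a 0 = 0` and each successive
approximation arises from one CoSaMP iteration. -/
def CoSaMPSeq {m N : ℕ} (Φ : Matrix (Fin m) (Fin N) ℂ) (u : Fin m → ℂ) (s : ℕ)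
    (a : ℕ → Fin N → ℂ) : Prop :=
  a 0 = 0 ∧ ∀ k, CoSaMPStep Φ u s (a k) (a (k + 1))

/-- The spectral norm (ℓ₂ → ℓ₂ operator norm) of a matrix. -/
noncomputable def specNorm {a b : Type*} [Fintype a] [Fintype b] (M : Matrix a b ℂ) : ℝ :=
  sSup ((fun x => l2 (M.mulVec x)) '' {x | l2 x ≤ 1})

theorem l2_eq_norm {ι : Type*} [Fintype ι] (x : ι → ℂ) : l2 x = ‖WithLp.toLp 2 x‖ :=
  (EuclideanSpace.norm_eq _).symm

theorem l2_sq {ι : Type*} [Fintype ι] (x : ι → ℂ) : l2 x ^ 2 = ∑ i, ‖x i‖ ^ 2 :=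
  Real.sq_sqrt (by positivity)

/-- Polarization for the squared norm of a sum. -/
theorem norm_sum_sq_eq_sum_polarization {E ι : Type*} [NormedAddCommGroup E]
    [InnerProductSpace ℂ E] (s : Finset ι) (a : ι → E) :
    ‖∑ j ∈ s, a j‖ ^ 2 =
      ∑ j ∈ s, ∑ k ∈ s, (‖a j + a k‖ ^ 2 - ‖a j - a k‖ ^ 2) / 4 := by
  rw [@norm_sq_eq_re_inner ℂ, sum_inner, map_sum]
  refine Finset.sum_congr rfl fun j _ => ?_
  rw [inner_sum, map_sum]
  refine Finset.sum_congr rfl fun k _ => ?_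
  rw [@norm_add_sq ℂ, @norm_sub_sq ℂ]
  ring

theorem l2_sum_sq_eq_sum_polarization {ι κ : Type*} [Fintype ι] (s : Finset κ)
    (a : κ → ι → ℂ) :
    l2 (∑ j ∈ s, a j) ^ 2 =
      ∑ j ∈ s, ∑ k ∈ s, (l2 (a j + a k) ^ 2 - l2 (a j - a k) ^ 2) / 4 := by
  simp only [l2_eq_norm, WithLp.toLp_sum, WithLp.toLp_add, WithLp.toLp_sub]
  exact norm_sum_sq_eq_sum_polarization s _

theorem l2_parallelogram {ι : Type*} [Fintype ι] (x y : ι → ℂ) :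
    l2 (x + y) ^ 2 + l2 (x - y) ^ 2 = 2 * (l2 x ^ 2 + l2 y ^ 2) := by
  simp only [l2_eq_norm, WithLp.toLp_add, WithLp.toLp_sub]
  have := parallelogram_law_with_norm ℂ (WithLp.toLp 2 x) (WithLp.toLp 2 y)
  linarith

/-- A finite set with at most `c * r` elements can be coloured with `c` colours so that every
colour class has at most `r` elements. -/
theorem exists_coloring_card_le {α : Type*} (S : Finset α) {c r : ℕ} (hc : 0 < c)
    (h : S.card ≤ c * r) :
    ∃ g : α → Fin c, ∀ k, (S.filter fun i => g i = k).card ≤ r := by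
  obtain ⟨e⟩ : Nonempty (S ↪ Fin c × Fin r) :=
    Function.Embedding.nonempty_of_card_le (by simpa using h)
  refine ⟨fun i => if hi : i ∈ S then (e ⟨i, hi⟩).1 else ⟨0, hc⟩, fun k => ?_⟩
  rw [← Finset.card_attach]
  refine le_of_le_of_eq (Finset.card_le_card_of_injOn (t := Finset.univ)
    (fun i => (e ⟨i.1, (Finset.mem_filter.1 i.2).1⟩).2) (by simp) ?_) (Finset.card_fin r)
  rintro ⟨i, hi⟩ - ⟨j, hj⟩ - hij
  rw [Finset.mem_filter] at hi hj
  have := e.injective (Prod.ext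
    ((dif_pos hi.1).symm.trans (hi.2.trans (hj.2.symm.trans (dif_pos hj.1)))) hij)
  simpa using this

theorem Sparse.add {N r s : ℕ} {x y : Fin N → ℂ} (hx : Sparse r x) (hy : Sparse s y) :
    Sparse (r + s) (x + y) := by
  refine (Finset.card_le_card (t := suppF x ∪ suppF y) fun i hi => ?_).trans
    ((Finset.card_union_le _ _).trans (add_le_add hx hy))
  by_contra h
  simp_all [suppF]

theorem Sparse.neg {N r : ℕ} {x : Fin N → ℂ} (hx : Sparse r x) : Sparse r (-x) := by
  simpa [Sparse, suppF] using hx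

theorem Sparse.sub {N r s : ℕ} {x y : Fin N → ℂ} (hx : Sparse r x) (hy : Sparse s y) :
    Sparse (r + s) (x - y) :=
  sub_eq_add_neg x y ▸ hx.add hy.neg

/-- A `c * r`-sparse vector is a sum of `c` vectors, each `r`-sparse, with disjoint supports. -/
theorem Sparse.exists_decomposition {N c r : ℕ} {x : Fin N → ℂ} (hc : 0 < c)
    (hx : Sparse (c * r) x) :
    ∃ y : Fin c → Fin N → ℂ, (∀ k, Sparse r (y k)) ∧ ∑ k, y k = x ∧
      ∑ k, l2 (y k) ^ 2 = l2 x ^ 2 := by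
  obtain ⟨g, hg⟩ := exists_coloring_card_le (suppF x) hc hx
  refine ⟨fun k i => if g i = k then x i else 0, fun k => ?_, ?_, ?_⟩
  · refine (Finset.card_le_card fun i hi => ?_).trans (hg k)
    simpa [suppF, and_comm] using hi
  · ext i
    simp
  · simp only [l2_sq]
    rw [Finset.sum_comm]
    refine Finset.sum_congr rfl fun i _ => ?_
    rw [Finset.sum_eq_single (g i)] <;> simp +contextual [eq_comm]

theorem exists_l2_mulVec_sq_le {m N : ℕ} (Φ : Matrix (Fin m) (Fin N) ℂ) :
    ∃ C, ∀ x, l2 (Φ.mulVec x) ^ 2 ≤ C * l2 x ^ 2 := by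
  refine ⟨∑ i, ∑ j, ‖Φ i j‖ ^ 2, fun x => ?_⟩
  rw [l2_sq, l2_sq, Finset.sum_mul]
  refine Finset.sum_le_sum fun i _ => ?_
  have h : ‖Φ.mulVec x i‖ ≤ ∑ j, ‖Φ i j‖ * ‖x j‖ := by
    simpa only [Matrix.mulVec, dotProduct, norm_mul] using
      norm_sum_le Finset.univ fun j => Φ i j * x j
  exact (pow_le_pow_left₀ (norm_nonneg _) h 2).trans (Finset.sum_mul_sq_le_sq_mul_sq _ _ _)

theorem exists_isometry_constant {m N : ℕ} (Φ : Matrix (Fin m) (Fin N) ℂ) (r : ℕ) :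
    ∃ δ : ℝ, 0 ≤ δ ∧ ∀ x : Fin N → ℂ, Sparse r x →
      (1 - δ) * l2 x ^ 2 ≤ l2 (Φ.mulVec x) ^ 2 ∧
        l2 (Φ.mulVec x) ^ 2 ≤ (1 + δ) * l2 x ^ 2 := by
  obtain ⟨C, hC⟩ := exists_l2_mulVec_sq_le Φ
  refine ⟨max 1 C, by positivity, fun x _ => ⟨?_, (hC x).trans ?_⟩⟩
  · exact (mul_nonpos_of_nonpos_of_nonneg (by simp) (sq_nonneg _)).trans (sq_nonneg _)
  · gcongr
    linarith [le_max_right 1 C]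

theorem isometry_constant_scaling {m N : ℕ} (Φ : Matrix (Fin m) (Fin N) ℂ) {c r : ℕ}
    (hc : 0 < c) {δ : ℝ}
    (h : ∀ x : Fin N → ℂ, Sparse (2 * r) x →
      (1 - δ) * l2 x ^ 2 ≤ l2 (Φ.mulVec x) ^ 2 ∧
        l2 (Φ.mulVec x) ^ 2 ≤ (1 + δ) * l2 x ^ 2)
    {x : Fin N → ℂ} (hx : Sparse (c * r) x) :
    (1 - c * δ) * l2 x ^ 2 ≤ l2 (Φ.mulVec x) ^ 2 ∧
      l2 (Φ.mulVec x) ^ 2 ≤ (1 + c * δ) * l2 x ^ 2 := by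
  obtain ⟨y, hy, hsum, hsq⟩ := hx.exists_decomposition hc
  have hpair (j k : Fin c) :
      |(l2 (Φ.mulVec (y j) + Φ.mulVec (y k)) ^ 2 -
          l2 (Φ.mulVec (y j) - Φ.mulVec (y k)) ^ 2) / 4 -
        (l2 (y j + y k) ^ 2 - l2 (y j - y k) ^ 2) / 4| ≤
      δ / 2 * (l2 (y j) ^ 2 + l2 (y k) ^ 2) := by
    have hp := h _ (two_mul r ▸ (hy j).add (hy k))
    have hm := h _ (two_mul r ▸ (hy j).sub (hy k))
    rw [Matrix.mulVec_add] at hp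
    rw [Matrix.mulVec_sub] at hm
    have hpl : δ * (l2 (y j + y k) ^ 2 + l2 (y j - y k) ^ 2) =
        δ * (2 * (l2 (y j) ^ 2 + l2 (y k) ^ 2)) := by rw [l2_parallelogram]
    rw [abs_le]
    constructor <;> linarith [hp.1, hp.2, hm.1, hm.2]
  have htotal : ∑ j, ∑ k, δ / 2 * (l2 (y j) ^ 2 + l2 (y k) ^ 2) = c * δ * l2 x ^ 2 := by
    simp only [← Finset.mul_sum, Finset.sum_add_distrib, Finset.sum_const, hsq,
      Finset.card_univ, Fintype.card_fin, nsmul_eq_mul]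
    ring
  have hdiff : |l2 (Φ.mulVec x) ^ 2 - l2 x ^ 2| ≤ c * δ * l2 x ^ 2 := by
    rw [← htotal, ← hsum, Matrix.mulVec_sum, l2_sum_sq_eq_sum_polarization,
      l2_sum_sq_eq_sum_polarization, ← Finset.sum_sub_distrib]
    refine (Finset.abs_sum_le_sum_abs _ _).trans (Finset.sum_le_sum fun j _ => ?_)
    rw [← Finset.sum_sub_distrib]
    exact (Finset.abs_sum_le_sum_abs _ _).trans (Finset.sum_le_sum fun k _ => hpair j k)
  rw [abs_le] at hdiff
  constructor <;> linarith [hdiff.1, hdiff.2]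

/-- **Scaling of restricted isometry constants.**  For positive integers `c` and `r`,
`δ_{cr}(Φ) ≤ c · δ_{2r}(Φ)`. -/
theorem ric_scaling
    {m N : ℕ} (Φ : Matrix (Fin m) (Fin N) ℂ) (c r : ℕ) (hc : 0 < c) (hr : 0 < r) :
    RIC Φ (c * r) ≤ (c : ℝ) * RIC Φ (2 * r) := by
  have hc' : (0 : ℝ) < c := Nat.cast_pos.2 hc
  rw [← div_le_iff₀' hc']
  refine le_csInf (exists_isometry_constant Φ (2 * r)) fun δ hδ => ?_
  rw [div_le_iff₀' hc']
  exact csInf_le ⟨0, fun _ h => h.1⟩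
    ⟨mul_nonneg hc'.le hδ.1, fun _ hx => isometry_constant_scaling Φ hc hδ.2 hx⟩
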